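/- Let a, m, t > 0 and let s be a real number with s ≠ 1. Define P(s,t) = (1/(2at)) ∫_{−a}^{a} ∫_{−t/2}^{t/2} exp( (m(s−1)/(2a)) · A(t/2, a, |x_l − x_o|) ) dx_l dx_o. Then: (i) if t < 2a, P(s,t) = ((a − t/2)/a) e^{m t (s−1)/(2a)} + 2 e^{m t (s−1)/(2a)}/(m(s−1)) + 4a(1 − e^{m t (s−1)/(2a)})/(m² t (s−1)²); (ii) if t > 2a, P(s,t) = (2/t) e^{m(s−1)} (t/2 − a) + 4a e^{m(s−1)}/(m t (s−1)) − 4a e^{m(s−1)}/(t m² (s−1)²) + 4a/(m² t (s−1)²). -/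

import Mathlib

open MeasureTheory Real intervalIntegral

/-- `A r a x` : length of the intersection of two 1D intervals of radii `r` and `a`
whose centers are at distance `x`. -/
noncomputable def interLen (r a x : ℝ) : ℝ :=
  if x ≤ |r - a| then 2 * min r a else if x ≤ r + a then r + a - x else 0

/-- Continuous form of the intersection length. -/
lemma interLen_eq (r a x : ℝ) (hr : 0 < r) (ha : 0 < a) :
    interLen r a x = max 0 (min (2 * min r a) (r + a - x)) := by
  unfold interLen
  rcases le_total r a with h | h
  · rw [abs_of_nonpos (by linarith), min_eq_left h]
    split_ifs with h1 h2
    · rw [min_eq_left (by linarith), max_eq_right (by linarith)]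
    · rw [min_eq_right (by linarith), max_eq_right (by linarith)]
    · rw [min_eq_right (by linarith), max_eq_left (by linarith)]
  · rw [abs_of_nonneg (by linarith), min_eq_right h]
    split_ifs with h1 h2
    · rw [min_eq_left (by linarith), max_eq_right (by linarith)]
    · rw [min_eq_right (by linarith), max_eq_right (by linarith)]
    · rw [min_eq_right (by linarith), max_eq_left (by linarith)]

lemma integral_exp_lin (c k e u v : ℝ) (hc : c ≠ 0) (he : e ≠ 0) :
    ∫ x in u..v, Real.exp (c * (k + e * x))
      = (Real.exp (c * (k + e * v)) - Real.exp (c * (k + e * u))) / (c * e) := by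
  have hd : ∀ x ∈ Set.uIcc u v, HasDerivAt (fun x => Real.exp (c * (k + e * x)) / (c * e))
      (Real.exp (c * (k + e * x))) x := by
    intro x _
    have h1 : HasDerivAt (fun x => c * (k + e * x)) (c * (e * 1)) x :=
      (((hasDerivAt_id x).const_mul e).const_add k).const_mul c
    have h2 := h1.exp.div_const (c * e)
    rw [mul_one, mul_div_cancel_right₀ _ (mul_ne_zero hc he)] at h2
    exact h2
  rw [integral_eq_sub_of_hasDerivAt hd (Continuous.intervalIntegrable (by fun_prop) _ _)]
  ring

lemma inner_int (p q c y : ℝ) (hp : 0 < p) (hpq : p < q) (hc : c ≠ 0) (hy : |y| ≤ p) :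
    ∫ x in (-q)..q, Real.exp (c * max 0 (min (2 * p) (p + q - |x - y|)))
      = 2 * (q - p) * Real.exp (c * (2 * p)) + (2 * Real.exp (c * (2 * p))
        - Real.exp (c * (p + 1 * y)) - Real.exp (c * (p + (-1) * y))) / c := by
  obtain ⟨hy1, hy2⟩ := abs_le.mp hy
  rw [integral_comp_sub_right (fun d => Real.exp (c * max 0 (min (2 * p) (p + q - |d|)))) y]
  have hI : ∀ u v : ℝ, IntervalIntegrable
      (fun d => Real.exp (c * max 0 (min (2 * p) (p + q - |d|)))) volume u v := fun u v =>
    Continuous.intervalIntegrable (by fun_prop) _ _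
  rw [← integral_add_adjacent_intervals (hI (-q - y) (-(q - p))) (hI _ (q - y)),
    ← integral_add_adjacent_intervals (hI (-(q - p)) (q - p)) (hI _ (q - y))]
  have e1 : ∫ d in (-q - y)..(-(q - p)), Real.exp (c * max 0 (min (2 * p) (p + q - |d|)))
      = ∫ d in (-q - y)..(-(q - p)), Real.exp (c * ((p + q) + 1 * d)) := by
    apply integral_congr
    intro d hd
    rw [Set.uIcc_of_le (by linarith)] at hd
    obtain ⟨h1, h2⟩ := hd
    simp only
    rw [abs_of_nonpos (by linarith), min_eq_right (by linarith), max_eq_right (by linarith)]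
    congr 1; ring
  have e2 : ∫ d in (-(q - p))..(q - p), Real.exp (c * max 0 (min (2 * p) (p + q - |d|)))
      = ∫ d in (-(q - p))..(q - p), Real.exp (c * (2 * p)) := by
    apply integral_congr
    intro d hd
    rw [Set.uIcc_of_le (by linarith)] at hd
    have := abs_le.mpr hd
    simp only
    rw [min_eq_left (by linarith), max_eq_right (by linarith)]
  have e3 : ∫ d in (q - p)..(q - y), Real.exp (c * max 0 (min (2 * p) (p + q - |d|)))
      = ∫ d in (q - p)..(q - y), Real.exp (c * ((p + q) + (-1) * d)) := by
    apply integral_congr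
    intro d hd
    rw [Set.uIcc_of_le (by linarith)] at hd
    obtain ⟨h1, h2⟩ := hd
    simp only
    rw [abs_of_nonneg (by linarith), min_eq_right (by linarith), max_eq_right (by linarith)]
    congr 1; ring
  rw [e1, e2, e3, integral_exp_lin _ _ _ _ _ hc (by norm_num),
    integral_exp_lin _ _ _ _ _ hc (by norm_num), intervalIntegral.integral_const, smul_eq_mul]
  rw [show p + q + 1 * -(q - p) = 2 * p by ring, show p + q + 1 * (-q - y) = p + (-1) * y by ring,
    show p + q + -1 * (q - y) = p + 1 * y by ring, show p + q + -1 * (q - p) = 2 * p by ring]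
  field_simp
  ring

lemma double_int (p q c : ℝ) (hp : 0 < p) (hpq : p < q) (hc : c ≠ 0) :
    ∫ y in (-p)..p, ∫ x in (-q)..q, Real.exp (c * max 0 (min (2 * p) (p + q - |x - y|)))
      = 4 * p * (q - p) * Real.exp (c * (2 * p)) + 4 * p * Real.exp (c * (2 * p)) / c
        - 2 * (Real.exp (c * (2 * p)) - 1) / c ^ 2 := by
  have e : ∫ y in (-p)..p, ∫ x in (-q)..q,
        Real.exp (c * max 0 (min (2 * p) (p + q - |x - y|)))
      = ∫ y in (-p)..p, (2 * (q - p) * Real.exp (c * (2 * p)) + (2 * Real.exp (c * (2 * p))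
        - Real.exp (c * (p + 1 * y)) - Real.exp (c * (p + (-1) * y))) / c) := by
    apply integral_congr
    intro y hy
    rw [Set.uIcc_of_le (by linarith)] at hy
    exact inner_int p q c y hp hpq hc (abs_le.mpr hy)
  rw [e, intervalIntegral.integral_add (Continuous.intervalIntegrable (by fun_prop) _ _)
    (Continuous.intervalIntegrable (by fun_prop) _ _), intervalIntegral.integral_div,
    intervalIntegral.integral_sub (Continuous.intervalIntegrable (by fun_prop) _ _)
    (Continuous.intervalIntegrable (by fun_prop) _ _),
    intervalIntegral.integral_sub (Continuous.intervalIntegrable (by fun_prop) _ _)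
    (Continuous.intervalIntegrable (by fun_prop) _ _),
    integral_exp_lin _ _ _ _ _ hc (by norm_num),
    integral_exp_lin _ _ _ _ _ hc (by norm_num), intervalIntegral.integral_const,
    intervalIntegral.integral_const, smul_eq_mul, smul_eq_mul]
  rw [show p + 1 * p = 2 * p by ring, show p + 1 * -p = 0 by ring,
    show p + -1 * p = 0 by ring, show p + -1 * -p = 2 * p by ring, mul_zero, Real.exp_zero]
  field_simp
  ring

/-- Closed form of the PGF of the number of tagged-platoon vehicles in the tagged serving
interval of length `t`. -/
theorem pgf_tagged_platoon_load (a m t s : ℝ) (ha : 0 < a) (hm : 0 < m) (ht : 0 < t)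
    (hs : s ≠ 1) :
    (t < 2 * a →
      (1 / (2 * a * t)) * ∫ xo in (-a)..a, ∫ xl in (-(t / 2))..(t / 2),
          Real.exp ((m * (s - 1) / (2 * a)) * interLen (t / 2) a |xl - xo|)
        = ((a - t / 2) / a) * Real.exp (m * t * (s - 1) / (2 * a))
          + 2 * Real.exp (m * t * (s - 1) / (2 * a)) / (m * (s - 1))
          + 4 * a * (1 - Real.exp (m * t * (s - 1) / (2 * a))) / (m ^ 2 * t * (s - 1) ^ 2))
    ∧ (2 * a < t →
      (1 / (2 * a * t)) * ∫ xo in (-a)..a, ∫ xl in (-(t / 2))..(t / 2),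
          Real.exp ((m * (s - 1) / (2 * a)) * interLen (t / 2) a |xl - xo|)
        = (2 / t) * Real.exp (m * (s - 1)) * (t / 2 - a)
          + 4 * a * Real.exp (m * (s - 1)) / (m * t * (s - 1))
          - 4 * a * Real.exp (m * (s - 1)) / (t * m ^ 2 * (s - 1) ^ 2)
          + 4 * a / (m ^ 2 * t * (s - 1) ^ 2)) := by
  have hs' : s - 1 ≠ 0 := sub_ne_zero.mpr hs
  have hc : m * (s - 1) / (2 * a) ≠ 0 := by positivity
  have ht2 : 0 < t / 2 := by linarith
  constructor
  · intro h
    have key := double_int (t / 2) a _ ht2 (by linarith) hc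
    have sw : ∫ xo in (-a)..a, ∫ xl in (-(t / 2))..(t / 2),
          Real.exp ((m * (s - 1) / (2 * a)) * interLen (t / 2) a |xl - xo|)
        = ∫ y in (-(t / 2))..(t / 2), ∫ x in (-a)..a, Real.exp ((m * (s - 1) / (2 * a)) *
          max 0 (min (2 * (t / 2)) (t / 2 + a - |x - y|))) := by
      simp only [interLen_eq _ _ _ ht2 ha, min_eq_left (show t / 2 ≤ a by linarith)]
      rw [intervalIntegral_intervalIntegral_swap]
      · refine integral_congr fun y _ => integral_congr fun x _ => ?_
        rw [abs_sub_comm]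
      · have hcont : Continuous (Function.uncurry fun x y : ℝ =>
            Real.exp ((m * (s - 1) / (2 * a)) *
              max 0 (min (2 * (t / 2)) (t / 2 + a - |y - x|)))) := by
          unfold Function.uncurry
          fun_prop
        exact (hcont.continuousOn.integrableOn_compact
          (isCompact_uIcc.prod isCompact_uIcc)).mono_set
          (Set.prod_mono Set.uIoc_subset_uIcc Set.uIoc_subset_uIcc)
    rw [sw, key, show m * (s - 1) / (2 * a) * (2 * (t / 2)) = m * t * (s - 1) / (2 * a) by ring]
    generalize Real.exp (m * t * (s - 1) / (2 * a)) = E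
    field_simp
    ring
  · intro h
    have key := double_int a (t / 2) _ ha (by linarith) hc
    simp only [interLen_eq _ _ _ ht2 ha, min_eq_right (show a ≤ t / 2 by linarith),
      add_comm (t / 2) a]
    rw [key, show m * (s - 1) / (2 * a) * (2 * a) = m * (s - 1) by field_simp]
    generalize Real.exp (m * (s - 1)) = E
    field_simp
    ring
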